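/- Let p and tp be IMP^TC programs, s a state, w : ℕ and n : ℕ. If every constant N m occurring in p, in tp, and in any IMP^W program called from p or tp satisfies m < 2^w, if s r < 2^w for every register r, and if tp ⊢ (p, s) ⇒ⁿ s', then s' r < 2^(w+n) for every register r. -/

import Mathlib

set_option autoImplicit false

/-- An IMP state maps register names to natural number values. -/
abbrev State := String → ℕ

/-- Atoms: constants and registers. -/
inductive Atom : Type where
  | N : ℕ → Atom
  | V : String → Atom

/-- Arithmetic expressions: atoms, addition, truncated subtraction of atoms. -/
inductive Aexp : Type where
  | atom : Atom → Aexp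
  | add : Atom → Atom → Aexp
  | sub : Atom → Atom → Aexp

/-- Evaluation of atoms. -/
def avalAtom : Atom → State → ℕ
  | .N n, _ => n
  | .V r, s => s r

/-- Evaluation of arithmetic expressions. -/
def aval : Aexp → State → ℕ
  | .atom A, s => avalAtom A s
  | .add A₁ A₂, s => avalAtom A₁ s + avalAtom A₂ s
  | .sub A₁ A₂, s => avalAtom A₁ s - avalAtom A₂ s

/-- Pointwise state update s[r ↦ v]. -/
def stUpd (s : State) (r : String) (v : ℕ) : State :=
  fun r' => if r = r' then v else s r'

/-- IMP^W commands. -/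
inductive ComW : Type where
  | assign : String → Aexp → ComW
  | seq : ComW → ComW → ComW
  | ifc : String → ComW → ComW → ComW
  | whl : String → ComW → ComW

/-- Big-step semantics of IMP^W with step counts: (p, s) ⇒ⁿ s'. -/
inductive BigStepW : ComW → State → ℕ → State → Prop where
  | assign (r : String) (a : Aexp) (s : State) :
      BigStepW (.assign r a) s 1 (stUpd s r (aval a s))
  | seq {p₁ p₂ : ComW} {s s' s'' : State} {n₁ n₂ : ℕ} :
      BigStepW p₁ s n₁ s' → BigStepW p₂ s' n₂ s'' →
      BigStepW (.seq p₁ p₂) s (n₁ + n₂ + 1) s''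
  | ifTrue {r : String} {p₁ p₂ : ComW} {s s' : State} {n : ℕ} :
      s r ≠ 0 → BigStepW p₁ s n s' → BigStepW (.ifc r p₁ p₂) s (n + 1) s'
  | ifFalse {r : String} {p₁ p₂ : ComW} {s s' : State} {n : ℕ} :
      s r = 0 → BigStepW p₂ s n s' → BigStepW (.ifc r p₁ p₂) s (n + 1) s'
  | whileFalse {r : String} {p : ComW} {s : State} :
      s r = 0 → BigStepW (.whl r p) s 1 s
  | whileTrue {r : String} {p : ComW} {s s' s'' : State} {n₁ n₂ : ℕ} :
      s r ≠ 0 → BigStepW p s n₁ s' → BigStepW (.whl r p) s' n₂ s'' →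
      BigStepW (.whl r p) s (n₁ + n₂ + 2) s''

/-- Constants occurring in an atom. -/
def constsAtom : Atom → List ℕ
  | .N n => [n]
  | .V _ => []

/-- Constants occurring in an arithmetic expression. -/
def constsAexp : Aexp → List ℕ
  | .atom A => constsAtom A
  | .add A₁ A₂ => constsAtom A₁ ++ constsAtom A₂
  | .sub A₁ A₂ => constsAtom A₁ ++ constsAtom A₂

/-- Constants occurring in an IMP^W program. -/
def constsW : ComW → List ℕ
  | .assign _ a => constsAexp a
  | .seq p₁ p₂ => constsW p₁ ++ constsW p₂
  | .ifc _ p₁ p₂ => constsW p₁ ++ constsW p₂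
  | .whl _ p => constsW p

/-- Registers of an atom. -/
def varsAtom : Atom → Finset String
  | .N _ => ∅
  | .V r => {r}

/-- Registers of an arithmetic expression. -/
def varsAexp : Aexp → Finset String
  | .atom A => varsAtom A
  | .add A₁ A₂ => varsAtom A₁ ∪ varsAtom A₂
  | .sub A₁ A₂ => varsAtom A₁ ∪ varsAtom A₂

/-- Registers occurring in an IMP^W program. -/
def varsW : ComW → Finset String
  | .assign r a => {r} ∪ varsAexp a
  | .seq p₁ p₂ => varsW p₁ ∪ varsW p₂
  | .ifc r p₁ p₂ => {r} ∪ varsW p₁ ∪ varsW p₂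
  | .whl r p => {r} ∪ varsW p

/-- IMP^TC commands: assignment, sequencing, if, calls of IMP^W programs, tail recursion. -/
inductive ComTC : Type where
  | assign : String → Aexp → ComTC
  | seq : ComTC → ComTC → ComTC
  | ifc : String → ComTC → ComTC → ComTC
  | call : ComW → String → ComTC
  | recurse : ComTC

/-- Registers occurring in an IMP^TC program (including called programs and return registers). -/
def varsTC : ComTC → Finset String
  | .assign r a => {r} ∪ varsAexp a
  | .seq p₁ p₂ => varsTC p₁ ∪ varsTC p₂
  | .ifc r p₁ p₂ => {r} ∪ varsTC p₁ ∪ varsTC p₂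
  | .call pc r => varsW pc ∪ {r}
  | .recurse => ∅

/-- Constants occurring in an IMP^TC program, including those of called IMP^W programs. -/
def constsTC : ComTC → List ℕ
  | .assign _ a => constsAexp a
  | .seq p₁ p₂ => constsTC p₁ ++ constsTC p₂
  | .ifc _ p₁ p₂ => constsTC p₁ ++ constsTC p₂
  | .call pc _ => constsW pc
  | .recurse => []

/-- Big-step semantics of IMP^TC relative to a context program `tp`,
with recursion cost constant `cR`: tp ⊢ (p, s) ⇒ⁿ s'. -/
inductive BigStepTC (cR : ℕ) (tp : ComTC) : ComTC → State → ℕ → State → Prop where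
  | assign (r : String) (a : Aexp) (s : State) :
      BigStepTC cR tp (.assign r a) s 1 (stUpd s r (aval a s))
  | seq {p₁ p₂ : ComTC} {s s' s'' : State} {n₁ n₂ : ℕ} :
      BigStepTC cR tp p₁ s n₁ s' → BigStepTC cR tp p₂ s' n₂ s'' →
      BigStepTC cR tp (.seq p₁ p₂) s (n₁ + n₂ + 1) s''
  | ifTrue {r : String} {p₁ p₂ : ComTC} {s s' : State} {n : ℕ} :
      s r ≠ 0 → BigStepTC cR tp p₁ s n s' → BigStepTC cR tp (.ifc r p₁ p₂) s (n + 1) s'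
  | ifFalse {r : String} {p₁ p₂ : ComTC} {s s' : State} {n : ℕ} :
      s r = 0 → BigStepTC cR tp p₂ s n s' → BigStepTC cR tp (.ifc r p₁ p₂) s (n + 1) s'
  | call {pc : ComW} {r : String} {s s₁ : State} {n : ℕ} :
      BigStepW pc s n s₁ → BigStepTC cR tp (.call pc r) s n (stUpd s r (s₁ r))
  | recurse {s s' : State} {n : ℕ} :
      BigStepTC cR tp tp s n s' → BigStepTC cR tp .recurse s (n + cR) s'

/-- Flagged big-step semantics of IMP^TC: runs a program but stops with flag 1
at tail-recursive calls; otherwise terminates with flag 0. -/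
inductive BigStepF : ComTC → State → ℕ → State → ℕ → Prop where
  | assign (r : String) (a : Aexp) (s : State) :
      BigStepF (.assign r a) s 1 (stUpd s r (aval a s)) 0
  | call {pc : ComW} {r : String} {s s₁ : State} {n : ℕ} :
      BigStepW pc s n s₁ → BigStepF (.call pc r) s n (stUpd s r (s₁ r)) 0
  | recurse (s : State) : BigStepF .recurse s 1 s 1
  | seq {p₁ p₂ : ComTC} {s s' s'' : State} {n₁ n₂ b : ℕ} :
      BigStepF p₁ s n₁ s' 0 → BigStepF p₂ s' n₂ s'' b →
      BigStepF (.seq p₁ p₂) s (n₁ + n₂ + 1) s'' b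
  | ifTrue {r : String} {p₁ p₂ : ComTC} {s s' : State} {n b : ℕ} :
      s r ≠ 0 → BigStepF p₁ s n s' b → BigStepF (.ifc r p₁ p₂) s (n + 1) s' b
  | ifFalse {r : String} {p₁ p₂ : ComTC} {s s' : State} {n b : ℕ} :
      s r = 0 → BigStepF p₂ s n s' b → BigStepF (.ifc r p₁ p₂) s (n + 1) s' b

/-- IMP^WC commands: IMP^W plus calls of IMP^W programs. -/
inductive ComWC : Type where
  | assign : String → Aexp → ComWC
  | seq : ComWC → ComWC → ComWC
  | ifc : String → ComWC → ComWC → ComWC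
  | whl : String → ComWC → ComWC
  | call : ComW → String → ComWC

/-- Big-step semantics of IMP^WC with step counts. -/
inductive BigStepWC : ComWC → State → ℕ → State → Prop where
  | assign (r : String) (a : Aexp) (s : State) :
      BigStepWC (.assign r a) s 1 (stUpd s r (aval a s))
  | seq {p₁ p₂ : ComWC} {s s' s'' : State} {n₁ n₂ : ℕ} :
      BigStepWC p₁ s n₁ s' → BigStepWC p₂ s' n₂ s'' →
      BigStepWC (.seq p₁ p₂) s (n₁ + n₂ + 1) s''
  | ifTrue {r : String} {p₁ p₂ : ComWC} {s s' : State} {n : ℕ} :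
      s r ≠ 0 → BigStepWC p₁ s n s' → BigStepWC (.ifc r p₁ p₂) s (n + 1) s'
  | ifFalse {r : String} {p₁ p₂ : ComWC} {s s' : State} {n : ℕ} :
      s r = 0 → BigStepWC p₂ s n s' → BigStepWC (.ifc r p₁ p₂) s (n + 1) s'
  | whileFalse {r : String} {p : ComWC} {s : State} :
      s r = 0 → BigStepWC (.whl r p) s 1 s
  | whileTrue {r : String} {p : ComWC} {s s' s'' : State} {n₁ n₂ : ℕ} :
      s r ≠ 0 → BigStepWC p s n₁ s' → BigStepWC (.whl r p) s' n₂ s'' →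
      BigStepWC (.whl r p) s (n₁ + n₂ + 2) s''
  | call {pc : ComW} {r : String} {s s₁ : State} {n : ℕ} :
      BigStepW pc s n s₁ → BigStepWC (.call pc r) s n (stUpd s r (s₁ r))

/-- Registers occurring in an IMP^WC program (including called programs and return registers). -/
def varsWC : ComWC → Finset String
  | .assign r a => {r} ∪ varsAexp a
  | .seq p₁ p₂ => varsWC p₁ ∪ varsWC p₂
  | .ifc r p₁ p₂ => {r} ∪ varsWC p₁ ∪ varsWC p₂
  | .whl r p => {r} ∪ varsWC p
  | .call pc r => varsW pc ∪ {r}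

/-- Substitute every occurrence of RECURSE in an IMP^TC program by the IMP^WC command `q`. -/
def substRec (q : ComWC) : ComTC → ComWC
  | .assign r a => .assign r a
  | .seq p₁ p₂ => .seq (substRec q p₁) (substRec q p₂)
  | .ifc r p₁ p₂ => .ifc r (substRec q p₁) (substRec q p₂)
  | .call pc r => .call pc r
  | .recurse => q

/-- (p, s) ⇒ⁿ_R s' for IMP^W. -/
def BigStepWPart (p : ComW) (s : State) (n : ℕ) (R : Finset String) (s' : State) : Prop :=
  ∃ (n' : ℕ) (s'' : State), n' ≤ n ∧ BigStepW p s n' s'' ∧ ∀ r ∈ R, s'' r = s' r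

/-- (p, s) ⇒ⁿ_R s' for IMP^WC. -/
def BigStepWCPart (p : ComWC) (s : State) (n : ℕ) (R : Finset String) (s' : State) : Prop :=
  ∃ (n' : ℕ) (s'' : State), n' ≤ n ∧ BigStepWC p s n' s'' ∧ ∀ r ∈ R, s'' r = s' r

/-- tp ⊢ (p, s) ⇒ⁿ_R s' for IMP^TC. -/
def BigStepTCPart (cR : ℕ) (tp p : ComTC) (s : State) (n : ℕ) (R : Finset String)
    (s' : State) : Prop :=
  ∃ (n' : ℕ) (s'' : State), n' ≤ n ∧ BigStepTC cR tp p s n' s'' ∧ ∀ r ∈ R, s'' r = s' r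

/-- Rename the registers of an atom along `m`. -/
def renameAtom (m : String → String) : Atom → Atom
  | .N n => .N n
  | .V r => .V (m r)

/-- Rename the registers of an arithmetic expression along `m`. -/
def renameAexp (m : String → String) : Aexp → Aexp
  | .atom A => .atom (renameAtom m A)
  | .add A₁ A₂ => .add (renameAtom m A₁) (renameAtom m A₂)
  | .sub A₁ A₂ => .sub (renameAtom m A₁) (renameAtom m A₂)

/-- Rename every register occurring in an IMP^W program along `m`. -/
def renameW (m : String → String) : ComW → ComW
  | .assign r a => .assign (m r) (renameAexp m a)
  | .seq p₁ p₂ => .seq (renameW m p₁) (renameW m p₂)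
  | .ifc r p₁ p₂ => .ifc (m r) (renameW m p₁) (renameW m p₂)
  | .whl r p => .whl (m r) (renameW m p)

theorem avalAtom_lt {A : Atom} {s : State} {B : ℕ} (hA : ∀ m ∈ constsAtom A, m < B)
    (hs : ∀ r, s r < B) : avalAtom A s < B := by
  cases A with
  | N n => exact hA n (by simp [constsAtom])
  | V r => exact hs r

theorem aval_lt {a : Aexp} {s : State} {k : ℕ} (ha : ∀ m ∈ constsAexp a, m < 2 ^ k)
    (hs : ∀ r, s r < 2 ^ k) : aval a s < 2 ^ (k + 1) := by
  cases a with
  | atom A =>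
    have h := avalAtom_lt (A := A) ha hs
    simp only [aval]
    omega
  | add A₁ A₂ =>
    simp only [constsAexp, List.forall_mem_append] at ha
    have h₁ := avalAtom_lt ha.1 hs
    have h₂ := avalAtom_lt ha.2 hs
    simp only [aval]
    omega
  | sub A₁ A₂ =>
    simp only [constsAexp, List.forall_mem_append] at ha
    have h₁ := avalAtom_lt ha.1 hs
    simp only [aval]
    omega

theorem stUpd_lt {s : State} {x : String} {v B : ℕ} (hs : ∀ r, s r < B) (hv : v < B) :
    ∀ r, stUpd s x v r < B := by
  intro r
  unfold stUpd
  split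
  · exact hv
  · exact hs r

theorem lt_two_pow_of_le {m k l : ℕ} (h : m < 2 ^ k) (hkl : k ≤ l) : m < 2 ^ l :=
  h.trans_le (Nat.pow_le_pow_right two_pos hkl)

theorem stUpd_aval_lt {a : Aexp} {s : State} {x : String} {w k : ℕ} (hwk : w ≤ k)
    (ha : ∀ m ∈ constsAexp a, m < 2 ^ w) (hs : ∀ r, s r < 2 ^ k) :
    ∀ r, stUpd s x (aval a s) r < 2 ^ (k + 1) :=
  stUpd_lt (fun r => lt_two_pow_of_le (hs r) k.le_succ)
    (aval_lt (fun m hm => lt_two_pow_of_le (ha m hm) hwk) hs)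

/-- The bound `2 ^ w` on the constants stays fixed while the bound `2 ^ k` on the registers
grows with the number of steps. -/
theorem BigStepW.lt_two_pow {p : ComW} {s s' : State} {n w k : ℕ} (h : BigStepW p s n s')
    (hwk : w ≤ k) (hp : ∀ m ∈ constsW p, m < 2 ^ w) (hs : ∀ r, s r < 2 ^ k) :
    ∀ r, s' r < 2 ^ (k + n) := by
  induction h generalizing k with
  | assign x a s => exact stUpd_aval_lt hwk hp hs
  | seq _ _ ih₁ ih₂ =>
    simp only [constsW, List.forall_mem_append] at hp
    intro r
    exact lt_two_pow_of_le (ih₂ (by omega) hp.2 (ih₁ hwk hp.1 hs) r) (by omega)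
  | ifTrue _ _ ih =>
    simp only [constsW, List.forall_mem_append] at hp
    exact fun r => lt_two_pow_of_le (ih hwk hp.1 hs r) (by omega)
  | ifFalse _ _ ih =>
    simp only [constsW, List.forall_mem_append] at hp
    exact fun r => lt_two_pow_of_le (ih hwk hp.2 hs r) (by omega)
  | whileFalse _ => exact fun r => lt_two_pow_of_le (hs r) (by omega)
  | whileTrue _ _ _ ih₁ ih₂ =>
    intro r
    exact lt_two_pow_of_le (ih₂ (by omega) hp (ih₁ hwk hp hs) r) (by omega)

theorem BigStepTC.lt_two_pow {cR : ℕ} {tp p : ComTC} {s s' : State} {n w k : ℕ}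
    (h : BigStepTC cR tp p s n s') (hwk : w ≤ k) (hp : ∀ m ∈ constsTC p, m < 2 ^ w)
    (htp : ∀ m ∈ constsTC tp, m < 2 ^ w) (hs : ∀ r, s r < 2 ^ k) :
    ∀ r, s' r < 2 ^ (k + n) := by
  induction h generalizing k with
  | assign x a s => exact stUpd_aval_lt hwk hp hs
  | seq _ _ ih₁ ih₂ =>
    simp only [constsTC, List.forall_mem_append] at hp
    intro r
    exact lt_two_pow_of_le (ih₂ (by omega) hp.2 (ih₁ hwk hp.1 hs) r) (by omega)
  | ifTrue _ _ ih =>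
    simp only [constsTC, List.forall_mem_append] at hp
    exact fun r => lt_two_pow_of_le (ih hwk hp.1 hs r) (by omega)
  | ifFalse _ _ ih =>
    simp only [constsTC, List.forall_mem_append] at hp
    exact fun r => lt_two_pow_of_le (ih hwk hp.2 hs r) (by omega)
  | call hc =>
    exact stUpd_lt (fun r => lt_two_pow_of_le (hs r) (by omega)) (hc.lt_two_pow hwk hp hs _)
  | recurse _ ih => exact fun r => lt_two_pow_of_le (ih hwk htp hs r) (by omega)

/-- If every constant occurring in the IMP^TC programs `p` and `tp` (including
those in called IMP^W programs) and every register value of `s` is below `2^w`,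
and `tp ⊢ (p, s) ⇒ⁿ s'`, then every register value of `s'` is below `2^(w+n)`. -/
theorem space_consumption_TC (cR : ℕ) (hcR : 0 < cR) (tp p : ComTC)
    (s s' : State) (w n : ℕ)
    (hp : ∀ m ∈ constsTC p, m < 2 ^ w)
    (htp : ∀ m ∈ constsTC tp, m < 2 ^ w)
    (hs : ∀ r : String, s r < 2 ^ w)
    (hstep : BigStepTC cR tp p s n s') :
    ∀ r : String, s' r < 2 ^ (w + n) := by
  exact hstep.lt_two_pow le_rfl hp htp hs
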